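/- Let Q_t denote the pure (undecohered) symmetric Hadamard walk on the line. Then for every complex z with |z| < 1, the generating function of its variances satisfies V₀(z) = Σ_{t≥1} Var(Q_t)·z^t = z/(1−z)² + (2z²/(1−z)³)·(1 − 1/√(1+z²)), where √(1+z²) is taken via the principal branch. -/

import Mathlib

noncomputable section

open Complex Filter

/-- Amplitude functions on the position × coin space `ℤ × {1,2}`
(coin `0` = "right", coin `1` = "left"). -/
abbrev QState := ℤ × Fin 2 → ℂ

/-- One step of the Hadamard walk: `(hadamardStep ψ) (x,n) = ⟨x,n|U ψ⟩`, where `U = S ∘ C`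
with `S` the chirality-conditioned shift and `C` the Hadamard coin. -/
def hadamardStep (ψ : QState) : QState := fun v =>
  if v.2 = 0 then (ψ (v.1 - 1, 0) + ψ (v.1 - 1, 1)) / (Real.sqrt 2 : ℂ)
  else (ψ (v.1 + 1, 0) - ψ (v.1 + 1, 1)) / (Real.sqrt 2 : ℂ)

/-- The basis state `|x,n⟩`. -/
def ket (x : ℤ) (n : Fin 2) : QState := fun v => if v = (x, n) then 1 else 0

/-- Pure Hadamard-walk probabilities `W_{m,n}(x,t) = |⟨x,n|U^t|0,m⟩|²`. -/
def W (m n : Fin 2) (x : ℤ) (t : ℕ) : ℝ := ‖(hadamardStep^[t] (ket 0 m)) (x, n)‖ ^ 2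

/-- Measurement operators, indexed by `𝔸 = {c} ∪ ℤ×{1,2}`:
`none` is the coherent projection `A_c = √(1-p)·I`, and `some (x,n)` is the
decoherence projection `A_{x,n} = √p |x,n⟩⟨x,n|`. -/
def measOp (p : ℝ) : Option (ℤ × Fin 2) → QState → QState
  | none => fun ψ v => (Real.sqrt (1 - p) : ℂ) * ψ v
  | some w => fun ψ v => if v = w then (Real.sqrt p : ℂ) * ψ w else 0

/-- The amplitude `(A_{j_t}U)⋯(A_{j_1}U)|0,m⟩` along the path `j`. -/
def pathAmp (p : ℝ) (m : Fin 2) : (t : ℕ) → (Fin t → Option (ℤ × Fin 2)) → QState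
  | 0, _ => ket 0 m
  | t + 1, j => measOp p (j (Fin.last t)) (hadamardStep (pathAmp p m t fun i => j i.castSucc))

/-- Decoherent Hadamard-walk probabilities
`P_{m,n}(x,t) = Σ_{j∈𝔸^t} |⟨x,n|(A_{j_t}U)⋯(A_{j_1}U)|0,m⟩|²`. -/
def Pdec (p : ℝ) (m n : Fin 2) (x : ℤ) (t : ℕ) : ℝ :=
  ∑' j : Fin t → Option (ℤ × Fin 2), ‖pathAmp p m t j (x, n)‖ ^ 2

/-- `Ŵ_{m,n}(k,t) = Σ_x W_{m,n}(x,t) e^{ikx}`. -/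
def What (m n : Fin 2) (k : ℝ) (t : ℕ) : ℂ :=
  ∑' x : ℤ, (W m n x t : ℂ) * Complex.exp (Complex.I * k * x)

/-- `P̂_{m,n}(k,z) = Σ_{t≥0} Σ_x P_{m,n}(x,t) e^{ikx} z^t`. -/
def Phat (p : ℝ) (m n : Fin 2) (k : ℝ) (z : ℂ) : ℂ :=
  ∑' t : ℕ, (∑' x : ℤ, (Pdec p m n x t : ℂ) * Complex.exp (Complex.I * k * x)) * z ^ t

/-- `Q̂_{m,n}(k,z) = (p/q) Σ_{t≥1} Ŵ_{m,n}(k,t) (qz)^t = p Σ_{t≥1} Ŵ_{m,n}(k,t) q^{t-1} z^t`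
with `q = 1-p`. -/
def Qhat (p : ℝ) (m n : Fin 2) (k : ℝ) (z : ℂ) : ℂ :=
  (p : ℂ) * ∑' t : ℕ, What m n k (t + 1) * ((1 - p : ℝ) : ℂ) ^ t * z ^ (t + 1)

/-- The matrix `P(k,z) = (P̂_{m,n}(k,z))`. -/
def Pmat (p k : ℝ) (z : ℂ) : Matrix (Fin 2) (Fin 2) ℂ := Matrix.of fun m n => Phat p m n k z

/-- The matrix `Q(k,z) = (Q̂_{m,n}(k,z))`. -/
def Qmat (p k : ℝ) (z : ℂ) : Matrix (Fin 2) (Fin 2) ℂ := Matrix.of fun m n => Qhat p m n k z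

/-- Maximum row-sum norm of a 2×2 complex matrix. -/
def rowSumNorm (A : Matrix (Fin 2) (Fin 2) ℂ) : ℝ :=
  max (‖A 0 0‖ + ‖A 0 1‖) (‖A 1 0‖ + ‖A 1 1‖)

/-- Distribution of the symmetric decoherent Hadamard walk:
`P(X_t = x) = (1/2) Σ_{m,n} P_{m,n}(x,t)`. -/
def PsymProb (p : ℝ) (x : ℤ) (t : ℕ) : ℝ := (1/2) * ∑ m : Fin 2, ∑ n : Fin 2, Pdec p m n x t

/-- Mean position of the symmetric decoherent walk. -/
def symMean (p : ℝ) (t : ℕ) : ℝ := ∑' x : ℤ, (x : ℝ) * PsymProb p x t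

/-- Variance of the symmetric decoherent walk. -/
def symVar (p : ℝ) (t : ℕ) : ℝ :=
  (∑' x : ℤ, (x : ℝ) ^ 2 * PsymProb p x t) - (∑' x : ℤ, (x : ℝ) * PsymProb p x t) ^ 2

/-- The symmetric generating function `P̂(k,z) = (1/2) Σ_{m,n} P̂_{m,n}(k,z)`. -/
def PhatSym (p k : ℝ) (z : ℂ) : ℂ := (1/2) * ∑ m : Fin 2, ∑ n : Fin 2, Phat p m n k z

/-- Characteristic function `P̂(k,t)` of the symmetric decoherent walk. -/
def charSym (p k : ℝ) (t : ℕ) : ℂ :=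
  ∑' x : ℤ, (PsymProb p x t : ℂ) * Complex.exp (Complex.I * k * x)

/-- Distribution of the decoherent walk started at `|0,1⟩`: `P(X̃_t = x) = Σ_n P_{1,n}(x,t)`. -/
def Ptilde (p : ℝ) (x : ℤ) (t : ℕ) : ℝ := ∑ n : Fin 2, Pdec p 0 n x t

/-- Mean position of the decoherent walk started at `|0,1⟩`. -/
def tildeMean (p : ℝ) (t : ℕ) : ℝ := ∑' x : ℤ, (x : ℝ) * Ptilde p x t

/-- Variance of the decoherent walk started at `|0,1⟩`. -/
def tildeVar (p : ℝ) (t : ℕ) : ℝ :=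
  (∑' x : ℤ, (x : ℝ) ^ 2 * Ptilde p x t) - (∑' x : ℤ, (x : ℝ) * Ptilde p x t) ^ 2

/-- Characteristic function of the decoherent walk started at `|0,1⟩`. -/
def charTilde (p k : ℝ) (t : ℕ) : ℂ :=
  ∑' x : ℤ, (Ptilde p x t : ℂ) * Complex.exp (Complex.I * k * x)

/-- The symmetric initial state `φ₀ = (|0,1⟩ + i|0,2⟩)/√2`. -/
def phi0 : QState := fun v =>
  if v = ((0 : ℤ), (0 : Fin 2)) then (1 / Real.sqrt 2 : ℂ)
  else if v = ((0 : ℤ), (1 : Fin 2)) then Complex.I / Real.sqrt 2 else 0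

/-- Distribution of the pure symmetric Hadamard walk: `P(Q_t = x) = Σ_n |⟨x,n|U^t|φ₀⟩|²`. -/
def Ppure (x : ℤ) (t : ℕ) : ℝ := ∑ n : Fin 2, ‖(hadamardStep^[t] phi0) (x, n)‖ ^ 2

/-- Variance of the pure symmetric Hadamard walk. -/
def pureVar (t : ℕ) : ℝ :=
  (∑' x : ℤ, (x : ℝ) ^ 2 * Ppure x t) - (∑' x : ℤ, (x : ℝ) * Ppure x t) ^ 2

/-- `E(k,z) = √((q²z² − (1+cos k)qz + 1)(q²z² + (1+cos k)qz + 1))`, principal branch. -/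
def Efun (q k : ℝ) (z : ℂ) : ℂ :=
  (((q : ℂ) ^ 2 * z ^ 2 - (1 + (Real.cos k : ℂ)) * (q : ℂ) * z + 1) *
    ((q : ℂ) ^ 2 * z ^ 2 + (1 + (Real.cos k : ℂ)) * (q : ℂ) * z + 1)) ^ ((1 : ℂ) / 2)


/-- The real amplitude `⟨v|U^t|0,m⟩`. -/
def amp (m : Fin 2) : ℕ → ℤ × Fin 2 → ℝ
  | 0 => fun v => if v = (0, m) then 1 else 0
  | t + 1 => fun v =>
    if v.2 = 0 then (amp m t (v.1 - 1, 0) + amp m t (v.1 - 1, 1)) / √2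
    else (amp m t (v.1 + 1, 0) - amp m t (v.1 + 1, 1)) / √2

lemma amp_zero (m n : Fin 2) (x : ℤ) : amp m 0 (x, n) = if x = 0 ∧ n = m then 1 else 0 := by
  simp [amp]

lemma amp_succ_right (m : Fin 2) (t : ℕ) (x : ℤ) :
    amp m (t + 1) (x, 0) = (amp m t (x - 1, 0) + amp m t (x - 1, 1)) / √2 := by
  simp [amp]

lemma amp_succ_left (m : Fin 2) (t : ℕ) (x : ℤ) :
    amp m (t + 1) (x, 1) = (amp m t (x + 1, 0) - amp m t (x + 1, 1)) / √2 := by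
  simp [amp]

lemma amp_eq_zero_of_lt (m n : Fin 2) (t : ℕ) (x : ℤ) (hx : (t : ℤ) < |x|) :
    amp m t (x, n) = 0 := by
  induction t generalizing x n with
  | zero =>
    have : x ≠ 0 := by rintro rfl; simp at hx
    simp [amp_zero, this]
  | succ t ih =>
    push_cast at hx
    have h1 : (t : ℤ) < |x - 1| := by grind
    have h2 : (t : ℤ) < |x + 1| := by grind
    fin_cases n
    · simp [amp_succ_right, ih _ _ h1]
    · simp [amp_succ_left, ih _ _ h2]

lemma summable_mul_amp (h : ℤ → ℝ) (m n : Fin 2) (t : ℕ) (y : ℤ) :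
    Summable fun x => h x * amp m t (x + y, n) := by
  apply summable_of_hasFiniteSupport
  refine (Set.finite_Icc (-(t : ℤ) - y) (t - y)).subset fun x hx => ?_
  by_contra hx'
  refine hx ?_
  have : (t : ℤ) < |x + y| := by
    simp only [Set.mem_Icc, not_and_or, not_le] at hx'
    grind
  simp [amp_eq_zero_of_lt m n t _ this]

lemma summable_mul_amp_sq (h : ℤ → ℝ) (m n : Fin 2) (t : ℕ) (y : ℤ) :
    Summable fun x => h x * amp m t (x + y, n) ^ 2 := by
  simpa only [sq, mul_assoc] using summable_mul_amp (fun x => h x * amp m t (x + y, n)) m n t y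

lemma hadamardStep_iterate_phi0 (t : ℕ) :
    hadamardStep^[t] phi0 = fun v => ((amp 0 t v : ℂ) + amp 1 t v * I) / (√2 : ℝ) := by
  induction t with
  | zero =>
    ext ⟨x, n⟩
    fin_cases n <;> by_cases hx : x = 0 <;> simp [phi0, amp_zero, hx]
  | succ t ih =>
    rw [Function.iterate_succ_apply', ih]
    ext ⟨x, n⟩
    fin_cases n
    · simp only [hadamardStep, Fin.zero_eta, amp_succ_right]
      push_cast
      simp
      ring
    · simp only [hadamardStep, Fin.mk_one, amp_succ_left]
      push_cast
      simp
      ring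

lemma Ppure_eq (x : ℤ) (t : ℕ) :
    Ppure x t = (1 / 2) * ∑ n : Fin 2, (amp 0 t (x, n) ^ 2 + amp 1 t (x, n) ^ 2) := by
  simp only [Ppure, hadamardStep_iterate_phi0, norm_div, Complex.norm_real, Finset.mul_sum]
  refine Finset.sum_congr rfl fun n _ => ?_
  rw [div_pow, Complex.sq_norm, Complex.normSq_add_mul_I]
  simp
  ring

/-- Decomposition of the walk according to its first step. -/
lemma amp_succ_eq_first_step (t : ℕ) (x : ℤ) (n : Fin 2) :
    amp 0 (t + 1) (x, n) = (amp 0 t (x - 1, n) + amp 1 t (x + 1, n)) / √2 ∧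
      amp 1 (t + 1) (x, n) = (amp 0 t (x - 1, n) - amp 1 t (x + 1, n)) / √2 := by
  induction t generalizing x n with
  | zero =>
    fin_cases n
    · simp [amp_succ_right, amp_zero]
    · simp [amp_succ_left, amp_zero]
  | succ t ih =>
    have l (m) := amp_succ_right m (t + 1) x
    have l' (m) := amp_succ_left m (t + 1) x
    have r (m) := amp_succ_right m t
    have r' (m) := amp_succ_left m t
    simp only [Fin.forall_fin_two, (ih _ _).1, (ih _ _).2, sub_add_cancel,
      add_sub_cancel_right] at l l'
    fin_cases n
    · simp only [Fin.zero_eta, l.1, l.2, r, add_sub_cancel_right]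
      constructor <;> ring
    · simp only [Fin.mk_one, l'.1, l'.2, r', sub_add_cancel]
      constructor <;> ring

/-- The `w`-weighted mass of the walk from `|0,m⟩` on the sites of chirality `n` at time `t`. -/
def moment (w : ℤ → ℝ) (m n : Fin 2) (t : ℕ) : ℝ := ∑' x, w x * amp m t (x, n) ^ 2

lemma summable_moment (w : ℤ → ℝ) (m n : Fin 2) (t : ℕ) :
    Summable fun x => w x * amp m t (x, n) ^ 2 := by
  simpa using summable_mul_amp_sq w m n t 0

lemma hasSum_moment_shift (w : ℤ → ℝ) (m n : Fin 2) (t : ℕ) (y : ℤ) :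
    HasSum (fun x => w x * amp m t (x + y, n) ^ 2) (moment (fun x => w (x - y)) m n t) := by
  rw [← (Equiv.subRight y).hasSum_iff]
  simpa [Function.comp_def, moment] using (summable_moment (fun x => w (x - y)) m n t).hasSum

lemma moment_add (v w : ℤ → ℝ) (m n : Fin 2) (t : ℕ) :
    moment (fun x => v x + w x) m n t = moment v m n t + moment w m n t := by
  simp only [moment, add_mul]
  exact (summable_moment v m n t).tsum_add (summable_moment w m n t)

lemma moment_sub (v w : ℤ → ℝ) (m n : Fin 2) (t : ℕ) :
    moment (fun x => v x - w x) m n t = moment v m n t - moment w m n t := by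
  simp only [moment, sub_mul]
  exact (summable_moment v m n t).tsum_sub (summable_moment w m n t)

lemma moment_const_mul (c : ℝ) (w : ℤ → ℝ) (m n : Fin 2) (t : ℕ) :
    moment (fun x => c * w x) m n t = c * moment w m n t := by
  simp only [moment, mul_assoc, tsum_mul_left]

lemma half_sq_add_half_sq (a b : ℝ) :
    ((a + b) / √2) ^ 2 + ((a - b) / √2) ^ 2 = a ^ 2 + b ^ 2 := by
  simp only [div_pow, Nat.ofNat_nonneg, Real.sq_sqrt]
  ring

lemma moment_first_step (w : ℤ → ℝ) (n : Fin 2) (t : ℕ) :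
    moment w 0 n (t + 1) + moment w 1 n (t + 1)
      = moment (fun x => w (x + 1)) 0 n t + moment (fun x => w (x - 1)) 1 n t := by
  have h0 := hasSum_moment_shift w 0 n t (-1)
  have h1 := hasSum_moment_shift w 1 n t 1
  simp only [sub_neg_eq_add] at h0
  rw [← (h0.add h1).tsum_eq, moment, moment,
    ← (summable_moment w 0 n _).tsum_add (summable_moment w 1 n _)]
  refine tsum_congr fun x => ?_
  rw [← mul_add, ← mul_add, (amp_succ_eq_first_step t x n).1, (amp_succ_eq_first_step t x n).2,
    half_sq_add_half_sq, ← sub_eq_add_neg]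

lemma moment_last_step (w : ℤ → ℝ) (m : Fin 2) (t : ℕ) :
    moment (fun x => w (x - 1)) m 0 (t + 1) + moment (fun x => w (x + 1)) m 1 (t + 1)
      = moment w m 0 t + moment w m 1 t := by
  have h0 := hasSum_moment_shift w m 0 (t + 1) 1
  have h1 := hasSum_moment_shift w m 1 (t + 1) (-1)
  simp only [sub_neg_eq_add] at h1
  rw [← (h0.add h1).tsum_eq, moment, moment,
    ← (summable_moment w m 0 _).tsum_add (summable_moment w m 1 _)]
  refine tsum_congr fun x => ?_
  rw [← mul_add, ← mul_add, amp_succ_right, amp_succ_left, add_sub_cancel_right,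
    neg_add_cancel_right, half_sq_add_half_sq]

lemma moment_zero (w : ℤ → ℝ) (m n : Fin 2) :
    moment w m n 0 = if n = m then w 0 else 0 := by
  rw [moment, tsum_eq_single 0 fun x hx => by simp [amp_zero, hx]]
  simp [amp_zero]

lemma moment_one_add_moment_one (m : Fin 2) (t : ℕ) :
    moment (fun _ => 1) m 0 t + moment (fun _ => 1) m 1 t = 1 := by
  induction t with
  | zero => fin_cases m <;> simp [moment_zero]
  | succ t ih => exact (moment_last_step (fun _ => 1) m t).trans ih

lemma moment_one_nonneg (m n : Fin 2) (t : ℕ) : 0 ≤ moment (fun _ => 1) m n t :=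
  tsum_nonneg fun x => by positivity

lemma tsum_mul_Ppure (w : ℤ → ℝ) (t : ℕ) :
    ∑' x, w x * Ppure x t = (1 / 2) * ∑ n, (moment w 0 n t + moment w 1 n t) := by
  have h := ((((summable_moment w 0 0 t).hasSum.add (summable_moment w 1 0 t).hasSum).add
    ((summable_moment w 0 1 t).hasSum.add (summable_moment w 1 1 t).hasSum)).mul_left (1 / 2))
  rw [Fin.sum_univ_two]
  refine Eq.trans (tsum_congr fun x => ?_) h.tsum_eq
  rw [Ppure_eq, Fin.sum_univ_two]
  ring

lemma mean_pure_eq_zero (t : ℕ) : ∑' x : ℤ, (x : ℝ) * Ppure x t = 0 := by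
  rw [tsum_mul_Ppure]
  induction t with
  | zero => simp [moment_zero]
  | succ t ih =>
    have h0 := moment_one_add_moment_one 0 t
    have h1 := moment_one_add_moment_one 1 t
    simp only [Fin.sum_univ_two, moment_first_step, Int.cast_add, Int.cast_sub, Int.cast_one,
      moment_add, moment_sub] at ih ⊢
    linarith

/-- The correlation between the initial chirality and the chirality at time `t`. -/
def coinCorr (t : ℕ) : ℝ :=
  (1 / 2) * (moment (fun _ => 1) 0 0 t - moment (fun _ => 1) 0 1 t
    - (moment (fun _ => 1) 1 0 t - moment (fun _ => 1) 1 1 t))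

/-- The correlation between the position and the chirality at time `t`. -/
def posCoinCorr (t : ℕ) : ℝ :=
  (1 / 2) * (moment (fun x => x) 0 0 t - moment (fun x => x) 0 1 t
    + (moment (fun x => x) 1 0 t - moment (fun x => x) 1 1 t))

lemma posCoinCorr_zero : posCoinCorr 0 = 0 := by simp [posCoinCorr, moment_zero]

lemma posCoinCorr_succ (t : ℕ) : posCoinCorr (t + 1) = posCoinCorr t + coinCorr t := by
  have h0 := moment_first_step (fun x => x) 0 t
  have h1 := moment_first_step (fun x => x) 1 t
  simp only [Int.cast_add, Int.cast_sub, Int.cast_one, moment_add, moment_sub] at h0 h1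
  simp only [posCoinCorr, coinCorr]
  linarith

lemma pureVar_eq (t : ℕ) : pureVar t = ∑' x : ℤ, (x : ℝ) ^ 2 * Ppure x t := by
  simp [pureVar, mean_pure_eq_zero]

lemma pureVar_zero : pureVar 0 = 0 := by
  rw [pureVar_eq, tsum_mul_Ppure (fun x => (x : ℝ) ^ 2)]
  simp [moment_zero]

lemma pureVar_succ (t : ℕ) : pureVar (t + 1) = pureVar t - 1 + 2 * posCoinCorr (t + 1) := by
  rw [pureVar_eq, pureVar_eq, tsum_mul_Ppure (fun x => (x : ℝ) ^ 2),
    tsum_mul_Ppure (fun x => (x : ℝ) ^ 2)]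
  have hs (m n) : moment (fun x : ℤ => (((x - 1 : ℤ)) : ℝ) ^ 2) m n (t + 1)
      = moment (fun x => (x : ℝ) ^ 2) m n (t + 1) + (-2) * moment (fun x => (x : ℝ)) m n (t + 1)
        + moment (fun _ => 1) m n (t + 1) := by
    rw [← moment_const_mul, ← moment_add, ← moment_add]
    congr 1
    ext x
    push_cast
    ring
  have ha (m n) : moment (fun x : ℤ => (((x + 1 : ℤ)) : ℝ) ^ 2) m n (t + 1)
      = moment (fun x => (x : ℝ) ^ 2) m n (t + 1) + 2 * moment (fun x => (x : ℝ)) m n (t + 1)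
        + moment (fun _ => 1) m n (t + 1) := by
    rw [← moment_const_mul, ← moment_add, ← moment_add]
    congr 1
    ext x
    push_cast
    ring
  have h0 := moment_last_step (fun x => (x : ℝ) ^ 2) 0 t
  have h1 := moment_last_step (fun x => (x : ℝ) ^ 2) 1 t
  have n0 := moment_one_add_moment_one 0 (t + 1)
  have n1 := moment_one_add_moment_one 1 (t + 1)
  rw [hs, ha] at h0 h1
  simp only [Fin.sum_univ_two, posCoinCorr]
  linarith

lemma abs_coinCorr_le (t : ℕ) : |coinCorr t| ≤ 1 := by
  have h (m n) := moment_one_nonneg m n t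
  have n0 := moment_one_add_moment_one 0 t
  have n1 := moment_one_add_moment_one 1 t
  rw [abs_le, coinCorr]
  constructor <;> linarith [h 0 0, h 0 1, h 1 0, h 1 1]

/-- The spatial correlation at distance `y` between the amplitudes of chiralities `n` and `n'`. -/
def ampCorr (m n n' : Fin 2) (t : ℕ) (y : ℤ) : ℝ := ∑' x, amp m t (x + y, n) * amp m t (x, n')

lemma hasSum_ampCorr (m n n' : Fin 2) (t : ℕ) (u v : ℤ) :
    HasSum (fun x => amp m t (x + u, n) * amp m t (x + v, n')) (ampCorr m n n' t (u - v)) := by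
  have h := (summable_mul_amp (fun x => amp m t (x + (u - v), n)) m n' t 0).hasSum
  rw [← (Equiv.addRight v).hasSum_iff] at h
  simpa [Function.comp_def, ampCorr, add_assoc] using h

lemma div_sqrt_two_mul_div_sqrt_two (a b : ℝ) : a / √2 * (b / √2) = (1 / 2) * (a * b) := by
  rw [div_mul_div_comm, Real.mul_self_sqrt zero_le_two]
  ring

lemma ampCorr_succ_right_right (m : Fin 2) (t : ℕ) (y : ℤ) :
    ampCorr m 0 0 (t + 1) y = (1 / 2) * (ampCorr m 0 0 t y + ampCorr m 0 1 t y
      + ampCorr m 1 0 t y + ampCorr m 1 1 t y) := by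
  have h (n n') := hasSum_ampCorr m n n' t (y - 1) (-1)
  rw [show y - 1 - -1 = y by ring] at h
  rw [← (((((h 0 0).add (h 0 1)).add (h 1 0)).add (h 1 1)).mul_left (1 / 2)).tsum_eq, ampCorr]
  refine tsum_congr fun x => ?_
  rw [amp_succ_right, amp_succ_right, div_sqrt_two_mul_div_sqrt_two, ← sub_eq_add_neg, ← add_sub_assoc]
  ring

lemma ampCorr_succ_left_left (m : Fin 2) (t : ℕ) (y : ℤ) :
    ampCorr m 1 1 (t + 1) y = (1 / 2) * (ampCorr m 0 0 t y - ampCorr m 0 1 t y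
      - ampCorr m 1 0 t y + ampCorr m 1 1 t y) := by
  have h (n n') := hasSum_ampCorr m n n' t (y + 1) 1
  rw [add_sub_cancel_right] at h
  rw [← (((((h 0 0).sub (h 0 1)).sub (h 1 0)).add (h 1 1)).mul_left (1 / 2)).tsum_eq, ampCorr]
  refine tsum_congr fun x => ?_
  rw [amp_succ_left, amp_succ_left, div_sqrt_two_mul_div_sqrt_two, ← add_assoc]
  ring

lemma ampCorr_succ_right_left (m : Fin 2) (t : ℕ) (y : ℤ) :
    ampCorr m 0 1 (t + 1) y = (1 / 2) * (ampCorr m 0 0 t (y - 2) - ampCorr m 0 1 t (y - 2)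
      + ampCorr m 1 0 t (y - 2) - ampCorr m 1 1 t (y - 2)) := by
  have h (n n') := hasSum_ampCorr m n n' t (y - 1) 1
  rw [show y - 1 - 1 = y - 2 by ring] at h
  rw [← (((((h 0 0).sub (h 0 1)).add (h 1 0)).sub (h 1 1)).mul_left (1 / 2)).tsum_eq, ampCorr]
  refine tsum_congr fun x => ?_
  rw [amp_succ_right, amp_succ_left, div_sqrt_two_mul_div_sqrt_two, ← add_sub_assoc]
  ring

lemma ampCorr_succ_left_right (m : Fin 2) (t : ℕ) (y : ℤ) :
    ampCorr m 1 0 (t + 1) y = (1 / 2) * (ampCorr m 0 0 t (y + 2) + ampCorr m 0 1 t (y + 2)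
      - ampCorr m 1 0 t (y + 2) - ampCorr m 1 1 t (y + 2)) := by
  have h (n n') := hasSum_ampCorr m n n' t (y + 1) (-1)
  rw [show y + 1 - -1 = y + 2 by ring] at h
  rw [← (((((h 0 0).add (h 0 1)).sub (h 1 0)).sub (h 1 1)).mul_left (1 / 2)).tsum_eq, ampCorr]
  refine tsum_congr fun x => ?_
  rw [amp_succ_left, amp_succ_right, div_sqrt_two_mul_div_sqrt_two, ← add_assoc, ← sub_eq_add_neg]
  ring

lemma ampCorr_zero (m n n' : Fin 2) (y : ℤ) :
    ampCorr m n n' 0 y = if y = 0 ∧ n = m ∧ n' = m then 1 else 0 := by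
  rw [ampCorr, tsum_eq_single 0 fun x hx => by simp [amp_zero, hx]]
  simp only [zero_add, amp_zero]
  split_ifs <;> simp_all

/-- The spatial version of `coinCorr`, at distance `y`. -/
def chiralCorr (t : ℕ) (y : ℤ) : ℝ :=
  (1 / 2) * (ampCorr 0 0 0 t y - ampCorr 0 1 1 t y - (ampCorr 1 0 0 t y - ampCorr 1 1 1 t y))

lemma chiralCorr_apply_zero (t : ℕ) : chiralCorr t 0 = coinCorr t := by
  simp [chiralCorr, coinCorr, ampCorr, moment, sq]

lemma chiralCorr_zero (y : ℤ) : chiralCorr 0 y = if y = 0 then 1 else 0 := by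
  by_cases hy : y = 0 <;> simp [chiralCorr, ampCorr_zero, hy]
  norm_num

lemma chiralCorr_one (y : ℤ) : chiralCorr 1 y = 0 := by
  simp [chiralCorr, ampCorr_succ_right_right, ampCorr_succ_left_left, ampCorr_zero]

lemma chiralCorr_two (y : ℤ) :
    chiralCorr 2 y = (1 / 2) * (chiralCorr 0 (y + 2) + chiralCorr 0 (y - 2)) := by
  simp only [chiralCorr, ampCorr_succ_right_right, ampCorr_succ_left_left, ampCorr_succ_right_left,
    ampCorr_succ_left_right, ampCorr_zero]
  simp
  split_ifs <;> norm_num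

lemma chiralCorr_add_three (t : ℕ) (y : ℤ) :
    chiralCorr (t + 3) y = chiralCorr t y
      - (1 / 2) * (chiralCorr (t + 2) (y + 2) - chiralCorr (t + 1) (y + 2)
        + (chiralCorr (t + 2) (y - 2) - chiralCorr (t + 1) (y - 2))) := by
  simp only [chiralCorr, ampCorr_succ_right_right, ampCorr_succ_left_left, ampCorr_succ_right_left,
    ampCorr_succ_left_right, add_sub_cancel_right, sub_add_cancel]
  ring

/-- The decrement in time of `chiralCorr` at even distances. -/
def chiralDecr (t : ℕ) (j : ℤ) : ℝ := chiralCorr t (2 * j) - chiralCorr (t + 1) (2 * j)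

lemma chiralDecr_zero (j : ℤ) : chiralDecr 0 j = if j = 0 then 1 else 0 := by
  simp [chiralDecr, chiralCorr_zero, chiralCorr_one]

lemma chiralDecr_one (j : ℤ) :
    chiralDecr 1 j = -(1 / 2) * (chiralDecr 0 (j + 1) + chiralDecr 0 (j - 1)) := by
  simp only [chiralDecr, zero_add, Nat.reduceAdd, chiralCorr_one, chiralCorr_two, mul_add, mul_sub,
    mul_one]
  ring

lemma chiralDecr_add_two (t : ℕ) (j : ℤ) :
    chiralDecr (t + 2) j = -chiralDecr (t + 1) j
      - (1 / 2) * (chiralDecr (t + 1) (j + 1) + chiralDecr (t + 1) (j - 1)) - chiralDecr t j := by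
  simp only [chiralDecr, chiralCorr_add_three, add_assoc, Nat.reduceAdd, mul_add, mul_sub, mul_one]
  ring

lemma abs_chiralDecr_le (t : ℕ) (j : ℤ) : |chiralDecr t j| ≤ 3 ^ t := by
  induction t using Nat.strong_induction_on generalizing j with
  | _ t ih =>
    match t with
    | 0 =>
      rw [chiralDecr_zero]
      split_ifs <;> simp
    | 1 =>
      have h0 := ih 0 one_pos (j + 1)
      have h1 := ih 0 one_pos (j - 1)
      rw [chiralDecr_one]
      simp only [abs_le] at *
      constructor <;> linarith
    | t + 2 =>
      have h0 := ih (t + 1) (by lia) j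
      have h1 := ih (t + 1) (by lia) (j + 1)
      have h2 := ih (t + 1) (by lia) (j - 1)
      have h3 := ih t (by lia) j
      have h4 : (0 : ℝ) < 3 ^ t := by positivity
      rw [chiralDecr_add_two]
      simp only [abs_le, pow_succ] at *
      constructor <;> linarith

lemma norm_chiralDecr_mul_pow_le (z : ℂ) (t : ℕ) (j : ℤ) :
    ‖(chiralDecr t j : ℂ) * z ^ t‖ ≤ (3 * ‖z‖) ^ t := by
  rw [norm_mul, Complex.norm_real, norm_pow, mul_pow]
  exact mul_le_mul_of_nonneg_right (abs_chiralDecr_le t j) (by positivity)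

/-- The generating function of `chiralDecr` at distance `j`. -/
def decrGen (z : ℂ) (j : ℤ) : ℂ := ∑' t, (chiralDecr t j : ℂ) * z ^ t

lemma hasSum_decrGen {z : ℂ} (hz : ‖z‖ < 1 / 8) (j : ℤ) :
    HasSum (fun t => (chiralDecr t j : ℂ) * z ^ t) (decrGen z j) :=
  (Summable.of_norm_bounded (summable_geometric_of_lt_one (by positivity) (by linarith))
    fun t => norm_chiralDecr_mul_pow_le z t j).hasSum

lemma norm_decrGen_le {z : ℂ} (hz : ‖z‖ < 1 / 8) (j : ℤ) : ‖decrGen z j‖ ≤ 2 := by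
  refine (tsum_of_norm_bounded (hasSum_geometric_of_lt_one (by positivity) (by linarith))
    fun t => norm_chiralDecr_mul_pow_le z t j).trans ?_
  rw [inv_le_comm₀ (by linarith) two_pos]
  linarith

lemma decrGen_recurrence {z : ℂ} (hz : ‖z‖ < 1 / 8) (j : ℤ) :
    (1 + z + z ^ 2) * decrGen z j + z / 2 * (decrGen z (j + 1) + decrGen z (j - 1))
      = (1 + z) * if j = 0 then 1 else 0 := by
  have h0 (j) := hasSum_decrGen hz j
  have h1 (j) : HasSum (fun t => (chiralDecr (t + 1) j : ℂ) * z ^ (t + 1))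
      (decrGen z j - chiralDecr 0 j) := by
    simpa using (hasSum_nat_add_iff' 1).mpr (h0 j)
  have h2 : HasSum (fun t => (chiralDecr (t + 2) j : ℂ) * z ^ (t + 2))
      (decrGen z j - (chiralDecr 0 j + chiralDecr 1 j * z)) := by
    simpa [Finset.sum_range_succ] using (hasSum_nat_add_iff' 2).mpr (h0 j)
  have h3 := (((h1 j).mul_left (-z)).sub
    (((h1 (j + 1)).add (h1 (j - 1))).mul_left (z / 2))).sub ((h0 j).mul_left (z ^ 2))
  have h4 := h2.unique (h3.congr_fun fun t => by rw [chiralDecr_add_two]; push_cast; ring)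
  rw [chiralDecr_one] at h4
  have h5 : (chiralDecr 0 j : ℂ) = if j = 0 then 1 else 0 := by
    rw [chiralDecr_zero]
    split_ifs <;> simp
  rw [← h5]
  push_cast at h4
  linear_combination h4

lemma eq_zero_of_recurrence {z : ℂ} (hz : ‖z‖ < 1 / 8) {h : ℤ → ℂ} {B : ℝ} (hB : ∀ j, ‖h j‖ ≤ B)
    (hh : ∀ j, (1 + z + z ^ 2) * h j + z / 2 * (h (j + 1) + h (j - 1)) = 0) (j : ℤ) :
    h j = 0 := by
  have hK : 3 / 4 ≤ ‖1 + z + z ^ 2‖ := by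
    have h1 : ‖(1 : ℂ)‖ ≤ ‖1 + z + z ^ 2‖ + (‖z‖ + ‖z ^ 2‖) := by
      calc ‖(1 : ℂ)‖ = ‖(1 + z + z ^ 2) - (z + z ^ 2)‖ := by ring_nf
        _ ≤ _ := (norm_sub_le _ _).trans (by gcongr; exact norm_add_le _ _)
    rw [norm_one, norm_pow] at h1
    nlinarith [norm_nonneg z]
  have hn (n : ℕ) : ∀ j, ‖h j‖ ≤ B * (1 / 2) ^ n := by
    induction n with
    | zero => simpa using hB
    | succ n ih =>
      intro j
      have h1 : ‖1 + z + z ^ 2‖ * ‖h j‖ = ‖z‖ / 2 * ‖h (j + 1) + h (j - 1)‖ := by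
        rw [← norm_mul, eq_neg_of_add_eq_zero_left (hh j), norm_neg, norm_mul, norm_div]
        simp
      have h2 := norm_add_le (h (j + 1)) (h (j - 1))
      have h3 := ih (j + 1)
      have h4 := ih (j - 1)
      rw [pow_succ]
      nlinarith [norm_nonneg z, norm_nonneg (h j), norm_nonneg (h (j + 1) + h (j - 1))]
  have hlim : Tendsto (fun n : ℕ => B * (1 / 2 : ℝ) ^ n) atTop (nhds 0) := by
    simpa using (tendsto_pow_atTop_nhds_zero_of_lt_one (r := (1 / 2 : ℝ)) (by norm_num)
      (by norm_num)).const_mul B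
  exact norm_le_zero_iff.mp (ge_of_tendsto' hlim fun n => hn n j)

lemma one_add_sq_mem_slitPlane {z : ℂ} (hz : ‖z‖ < 1) : 1 + z ^ 2 ∈ slitPlane := by
  apply mem_slitPlane_of_norm_lt_one
  rw [norm_pow]
  nlinarith [norm_nonneg z]

lemma cpow_half_sq (w : ℂ) : (w ^ ((1 : ℂ) / 2)) ^ 2 = w := by
  rw [one_div, Complex.cpow_ofNat_inv_pow]

lemma cpow_half_re_nonneg (w : ℂ) : 0 ≤ (w ^ ((1 : ℂ) / 2)).re := by
  rw [one_div, Complex.cpow_inv_two_re]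
  positivity

lemma decrGen_zero_of_norm_lt {z : ℂ} (hz : ‖z‖ < 1 / 8) :
    decrGen z 0 = 1 / (1 + z ^ 2) ^ ((1 : ℂ) / 2) := by
  set s := (1 + z ^ 2) ^ ((1 : ℂ) / 2) with hs
  have hs2 : s ^ 2 = 1 + z ^ 2 := cpow_half_sq _
  have hs_re : 0 ≤ s.re := cpow_half_re_nonneg _
  have hs0 : s ≠ 0 := by
    rw [← pow_ne_zero_iff two_ne_zero, hs2]
    exact slitPlane_ne_zero (one_add_sq_mem_slitPlane (by linarith))
  have hs1 : ‖s - 1‖ ≤ 1 / 8 := by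
    have h1 : ‖s - 1‖ * ‖s + 1‖ = ‖z‖ ^ 2 := by
      rw [← norm_mul, ← norm_pow]
      congr 1
      linear_combination hs2
    have h2 : 1 ≤ ‖s + 1‖ := by
      refine le_trans ?_ (Complex.re_le_norm _)
      simpa using hs_re
    nlinarith [norm_nonneg (s - 1), norm_nonneg z]
  have hnum : ‖1 + z - s‖ ≤ 1 / 4 := by
    calc ‖1 + z - s‖ = ‖z - (s - 1)‖ := by ring_nf
      _ ≤ ‖z‖ + ‖s - 1‖ := norm_sub_le _ _
      _ ≤ 1 / 4 := by linarith
  have hden : 1 ≤ ‖1 + z + s‖ := by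
    have h1 : ‖(2 : ℂ)‖ ≤ ‖1 + z + s‖ + (‖z‖ + ‖s - 1‖) := by
      calc ‖(2 : ℂ)‖ = ‖(1 + z + s) - (z + (s - 1))‖ := by ring_nf
        _ ≤ _ := (norm_sub_le _ _).trans (by gcongr; exact norm_add_le _ _)
    rw [Complex.norm_ofNat] at h1
    linarith
  have hden0 : 1 + z + s ≠ 0 := norm_pos_iff.mp (by linarith)
  set r := -(1 + z - s) / (1 + z + s) with hr
  have hrd : r * (1 + z + s) = -(1 + z - s) := div_mul_cancel₀ _ hden0
  have hr1 : ‖r‖ ≤ 1 := by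
    rw [hr, norm_div, norm_neg]
    exact div_le_one_of_le₀ (by linarith) (norm_nonneg _)
  have hr_origin : 1 + z + z ^ 2 + z * r = (1 + z) * s := by
    apply mul_right_cancel₀ hden0
    linear_combination z * hrd - (1 + z) * hs2
  have hr_quad : (1 + z + z ^ 2) * r + z / 2 * (r ^ 2 + 1) = 0 := by
    apply mul_right_cancel₀ (pow_ne_zero 2 hden0)
    linear_combination ((1 + z + z ^ 2) * (1 + z + s)
      + z / 2 * (r * (1 + z + s) - (1 + z - s))) * hrd + (1 + z + z ^ 2 + z) * hs2
  have key := eq_zero_of_recurrence hz (h := fun j => decrGen z j - r ^ j.natAbs / s)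
    (B := 2 + 1 / ‖s‖) (fun j => ?_) (fun j => ?_) 0
  · simpa [sub_eq_zero] using key
  · refine (norm_sub_le _ _).trans (add_le_add (norm_decrGen_le hz j) ?_)
    rw [norm_div, norm_pow]
    gcongr
    exact pow_le_one₀ (norm_nonneg _) hr1
  · have hrec := decrGen_recurrence hz j
    have hpow : (1 + z + z ^ 2) * r ^ j.natAbs + z / 2 * (r ^ (j + 1).natAbs + r ^ (j - 1).natAbs)
        = s * ((1 + z) * if j = 0 then 1 else 0) := by
      rcases eq_or_ne j 0 with rfl | hj
      · simp only [Int.natAbs_zero, zero_add, zero_sub, Int.natAbs_neg, Int.natAbs_one, if_true]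
        linear_combination hr_origin
      · obtain ⟨n, hn⟩ := Nat.exists_eq_succ_of_ne_zero (Int.natAbs_ne_zero.mpr hj)
        have h2 : r ^ (j + 1).natAbs + r ^ (j - 1).natAbs = r ^ (n + 2) + r ^ n := by
          rcases lt_or_gt_of_ne hj with hj' | hj'
          · rw [show (j + 1).natAbs = n by lia, show (j - 1).natAbs = n + 2 by lia, add_comm]
          · rw [show (j + 1).natAbs = n + 2 by lia, show (j - 1).natAbs = n by lia]
        rw [h2, hn, if_neg hj, Nat.succ_eq_add_one]
        linear_combination r ^ n * hr_quad
    apply mul_right_cancel₀ hs0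
    field_simp
    linear_combination 2 * s * hrec - 2 * hpow

lemma chiralDecr_apply_zero (t : ℕ) : chiralDecr t 0 = coinCorr t - coinCorr (t + 1) := by
  simp [chiralDecr, chiralCorr_apply_zero]

lemma abs_chiralDecr_apply_zero_le (t : ℕ) : |chiralDecr t 0| ≤ 2 := by
  rw [chiralDecr_apply_zero]
  have h0 := abs_le.mp (abs_coinCorr_le t)
  have h1 := abs_le.mp (abs_coinCorr_le (t + 1))
  rw [abs_le]
  constructor <;> linarith

lemma decrGen_zero {z : ℂ} (hz : ‖z‖ < 1) :
    decrGen z 0 = 1 / (1 + z ^ 2) ^ ((1 : ℂ) / 2) := by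
  obtain ⟨ρ, hzρ, hρ⟩ := exists_between hz
  have hρ0 : 0 < ρ := (norm_nonneg z).trans_lt hzρ
  have hL : DifferentiableOn ℂ (fun w => decrGen w 0) (Metric.ball 0 ρ) := by
    refine differentiableOn_tsum_of_summable_norm (u := fun t => 2 * ρ ^ t)
      ((summable_geometric_of_lt_one hρ0.le hρ).mul_left 2) (fun t => by fun_prop)
      Metric.isOpen_ball fun t w hw => ?_
    rw [mem_ball_zero_iff] at hw
    rw [norm_mul, Complex.norm_real, norm_pow]
    gcongr
    exact abs_chiralDecr_apply_zero_le t
  have hR : DifferentiableOn ℂ (fun w : ℂ => 1 / (1 + w ^ 2) ^ ((1 : ℂ) / 2))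
      (Metric.ball 0 ρ) := by
    intro w hw
    rw [mem_ball_zero_iff] at hw
    have hs := one_add_sq_mem_slitPlane (hw.trans hρ)
    have hne : (1 + w ^ 2) ^ ((1 : ℂ) / 2) ≠ 0 := by
      simp [Complex.cpow_eq_zero_iff, slitPlane_ne_zero hs]
    refine DifferentiableAt.differentiableWithinAt ?_
    exact (differentiableAt_const _).div
      (((differentiableAt_const _).add (differentiableAt_id.pow 2)).cpow_const hs) hne
  refine (hL.analyticOnNhd Metric.isOpen_ball).eqOn_of_preconnected_of_eventuallyEq
    (hR.analyticOnNhd Metric.isOpen_ball) (convex_ball _ _).isPreconnected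
    (Metric.mem_ball_self hρ0) ?_ (mem_ball_zero_iff.mpr hzρ)
  filter_upwards [Metric.ball_mem_nhds (0 : ℂ) (by norm_num : (0 : ℝ) < 1 / 8)] with w hw
  exact decrGen_zero_of_norm_lt (mem_ball_zero_iff.mp hw)

lemma summable_mul_pow_of_abs_le {c : ℕ → ℝ} {k : ℕ} {B : ℝ} (hc : ∀ t, |c t| ≤ B * t ^ k)
    {z : ℂ} (hz : ‖z‖ < 1) : Summable fun t => (c t : ℂ) * z ^ t := by
  have hs := (summable_pow_mul_geometric_of_norm_lt_one k (r := ‖z‖) (by simpa)).mul_left B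
  refine Summable.of_norm_bounded hs fun t => ?_
  rw [norm_mul, Complex.norm_real, norm_pow, ← mul_assoc]
  gcongr
  exact hc t

lemma abs_posCoinCorr_le (t : ℕ) : |posCoinCorr t| ≤ t := by
  induction t with
  | zero => simp [posCoinCorr_zero]
  | succ t ih =>
    rw [posCoinCorr_succ]
    push_cast
    exact (abs_add_le _ _).trans (add_le_add ih (abs_coinCorr_le t))

lemma abs_pureVar_le (t : ℕ) : |pureVar t| ≤ 3 * t ^ 2 := by
  induction t with
  | zero => simp [pureVar_zero]
  | succ t ih =>
    have h := abs_posCoinCorr_le (t + 1)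
    rw [pureVar_succ]
    push_cast at h ⊢
    rw [abs_le] at *
    constructor <;> nlinarith [Nat.cast_nonneg (α := ℝ) t]

lemma coinCorr_zero : coinCorr 0 = 1 := by
  norm_num [coinCorr, moment_zero]

lemma hasSum_coinCorr {z : ℂ} (hz : ‖z‖ < 1) :
    HasSum (fun t => (coinCorr t : ℂ) * z ^ t)
      ((1 - z * (1 / (1 + z ^ 2) ^ ((1 : ℂ) / 2))) / (1 - z)) := by
  have hz1 : 1 - z ≠ 0 := sub_ne_zero.mpr fun h => by simp [← h] at hz
  have hD := (summable_mul_pow_of_abs_le (c := coinCorr) (k := 0) (B := 1)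
    (by simpa using abs_coinCorr_le) hz).hasSum
  have hE := (summable_mul_pow_of_abs_le (c := fun t => chiralDecr t 0) (k := 0) (B := 2)
    (by simpa using abs_chiralDecr_apply_zero_le) hz).hasSum.mul_left z
  have hD1 := (hasSum_nat_add_iff' 1).mpr hD
  have h := hE.unique ((hD.mul_left z).sub hD1 |>.congr_fun fun t => by
    rw [chiralDecr_apply_zero]; push_cast; ring)
  rw [show ∑' t, (chiralDecr t 0 : ℂ) * z ^ t = decrGen z 0 from rfl, decrGen_zero hz] at h
  convert hD using 1
  rw [div_eq_iff hz1]
  simp only [Finset.sum_range_one, coinCorr_zero, ofReal_one, pow_zero, mul_one] at h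
  linear_combination -h

lemma hasSum_posCoinCorr {z D : ℂ} (hz : ‖z‖ < 1)
    (hD : HasSum (fun t => (coinCorr t : ℂ) * z ^ t) D) :
    HasSum (fun t => (posCoinCorr t : ℂ) * z ^ t) (z * D / (1 - z)) := by
  have hz1 : 1 - z ≠ 0 := sub_ne_zero.mpr fun h => by simp [← h] at hz
  have hL := (summable_mul_pow_of_abs_le (c := posCoinCorr) (k := 1) (B := 1)
    (by simpa using abs_posCoinCorr_le) hz).hasSum
  have hL1 := (hasSum_nat_add_iff' 1).mpr hL
  have h := hL1.unique (((hL.mul_left z).add (hD.mul_left z)).congr_fun fun t => by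
    rw [posCoinCorr_succ]; push_cast; ring)
  convert hL using 1
  rw [div_eq_iff hz1]
  simp only [Finset.sum_range_one, posCoinCorr_zero, ofReal_zero, zero_mul] at h
  linear_combination -h

/-- Generating function of the variances of the pure symmetric Hadamard walk:
`V₀(z) = Σ_{t≥1} Var(Q_t) z^t = z/(1-z)² + (2z²/(1-z)³)(1 - 1/√(1+z²))`. -/
theorem pure_variance_generating_function (z : ℂ) (hz : ‖z‖ < 1) :
    ∑' t : ℕ, ((pureVar (t + 1) : ℝ) : ℂ) * z ^ (t + 1)
      = z / (1 - z) ^ 2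
        + (2 * z ^ 2 / (1 - z) ^ 3) * (1 - 1 / ((1 + z ^ 2) ^ ((1 : ℂ) / 2))) := by
  have hz1 : 1 - z ≠ 0 := sub_ne_zero.mpr fun h => by simp [← h] at hz
  have hL := hasSum_posCoinCorr hz (hasSum_coinCorr hz)
  have hL1 := (hasSum_nat_add_iff' 1).mpr hL
  have hV := (summable_mul_pow_of_abs_le abs_pureVar_le hz).hasSum
  have hV1 := (hasSum_nat_add_iff' 1).mpr hV
  have hG := (hasSum_geometric_of_norm_lt_one hz).mul_left z
  have h := hV1.unique ((((hV.mul_left z).sub hG).add (hL1.mul_left 2)).congr_fun fun t => by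
    rw [pureVar_succ]; push_cast; ring)
  rw [hV1.tsum_eq]
  simp only [Finset.sum_range_one, posCoinCorr_zero, pureVar_zero, ofReal_zero, zero_mul,
    sub_zero] at h ⊢
  generalize 1 / (1 + z ^ 2) ^ ((1 : ℂ) / 2) = F at h ⊢
  generalize ∑' t, (pureVar t : ℂ) * z ^ t = V at h ⊢
  apply mul_right_cancel₀ hz1
  have h' : V * (1 - z) = -(z * (1 - z)⁻¹) + 2 * (z * ((1 - z * F) / (1 - z)) / (1 - z)) := by
    linear_combination h
  rw [h']
  field_simp
  ring

end
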